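/- Combining binary subsystem codes: If there exist a pure [[n_1,k_1,r_1,d_1]]_2 Clifford subsystem code and a pure [[n_2,k_2,r_2,d_2]]_2 Clifford subsystem code such that k_2 + r_2 ≤ n_1, then for every r in the range 0 ≤ r < k_1 + r_1 there exists an [[n_1 + n_2 − k_2 − r_2, k_1 + r_1 − r, r, d]]_2 Clifford subsystem code whose minimum distance satisfies d ≥ min{d_1, d_1 + d_2 − k_2 − r_2}. -/

import Mathlib

open Finset

/-- Symplectic weight of a vector `(a|b) ∈ F_q^n × F_q^n`. -/
noncomputable def swt {F : Type} [Field F] {n : ℕ} (v : (Fin n → F) × (Fin n → F)) : ℕ :=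
  {i : Fin n | ¬(v.1 i = 0 ∧ v.2 i = 0)}.ncard

/-- Minimum symplectic weight of a nonzero element of a set. -/
noncomputable def minSwt {F : Type} [Field F] {n : ℕ} (S : Set ((Fin n → F) × (Fin n → F))) : ℕ :=
  sInf (swt '' (S \ {0}))

/-- The trace-symplectic form on `F_q^{2n}`. -/
noncomputable def trSympForm (p : ℕ) {F : Type} [Field F] [Fintype F] [CharP F p] {n : ℕ}
    (u v : (Fin n → F) × (Fin n → F)) : ZMod p :=
  letI := ZMod.algebra F p
  Algebra.trace (ZMod p) F (∑ i, (v.1 i * u.2 i - u.1 i * v.2 i))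

/-- The trace-symplectic dual of a set of vectors in `F_q^{2n}`. -/
def sympDual (p : ℕ) {F : Type} [Field F] [Fintype F] [CharP F p] {n : ℕ}
    (C : Set ((Fin n → F) × (Fin n → F))) : Set ((Fin n → F) × (Fin n → F)) :=
  {v | ∀ w ∈ C, trSympForm p v w = 0}

/-- `C` (an additive code in `F_q^{2n}`) defines an `((n,K,R,d))_q` Clifford subsystem code. -/
def IsSubsysCode (p : ℕ) {F : Type} [Field F] [Fintype F] [CharP F p] {n : ℕ}
    (C : AddSubgroup ((Fin n → F) × (Fin n → F))) (K R d : ℕ) : Prop :=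
  let Ds : Set ((Fin n → F) × (Fin n → F)) := ↑C ∩ sympDual p ↑C
  Nat.card Ds * (K * R) = Fintype.card F ^ n ∧
  Nat.card C * K = Fintype.card F ^ n * R ∧
  (sympDual p Ds = ↑C → d = minSwt (sympDual p Ds)) ∧
  (sympDual p Ds ≠ ↑C → d = minSwt (sympDual p Ds \ ↑C))

/-- The subsystem code defined by `C` is pure to `d'`. -/
def PureTo {F : Type} [Field F] {n : ℕ}
    (C : AddSubgroup ((Fin n → F) × (Fin n → F))) (d' : ℕ) : Prop :=
  ∀ v ∈ C, v ≠ 0 → d' ≤ swt v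

/-- The subsystem code defined by `C` is `F_q`-linear. -/
def FqLinear {F : Type} [Field F] {n : ℕ}
    (C : AddSubgroup ((Fin n → F) × (Fin n → F))) : Prop :=
  ∀ (a : F), ∀ v ∈ C, a • v ∈ C

/-- Hamming weight.-/
noncomputable def hwt {F : Type} [Field F] {n : ℕ} (v : Fin n → F) : ℕ := {i | v i ≠ 0}.ncard

/-- Minimum Hamming weight of a nonzero element of a set. -/
noncomputable def minHwt {F : Type} [Field F] {n : ℕ} (S : Set (Fin n → F)) : ℕ :=
  sInf (hwt '' (S \ {0}))

/-- Euclidean dual. -/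
def euclDual {F : Type} [Field F] {n : ℕ} (C : Set (Fin n → F)) : Set (Fin n → F) :=
  {x | ∀ y ∈ C, ∑ i, x i * y i = 0}

/-- Hermitian dual (with respect to `x ↦ x^q`). -/
def hermDual (q : ℕ) {K : Type} [Field K] {n : ℕ} (C : Set (Fin n → K)) : Set (Fin n → K) :=
  {x | ∀ y ∈ C, ∑ i, x i ^ q * y i = 0}

/-- Cyclotomic coset of `a` modulo `n` (w.r.t. multiplier `q`). -/
def cycCoset (q n : ℕ) (a : ZMod n) : Set (ZMod n) := {x | ∃ i : ℕ, x = a * (q : ZMod n) ^ i}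

section Helpers

open Module

/-- The binary symplectic space of length `n`. -/
abbrev SympV (n : ℕ) : Type := (Fin n → ZMod 2) × (Fin n → ZMod 2)

/-- The symplectic form as a bilinear form. -/
noncomputable def sympB (n : ℕ) : LinearMap.BilinForm (ZMod 2) (SympV n) :=
  LinearMap.mk₂ (ZMod 2) (fun u v => ∑ i, (v.1 i * u.2 i - u.1 i * v.2 i))
    (by intro a b c; rw [← Finset.sum_add_distrib]; refine Finset.sum_congr rfl fun i _ => ?_
        simp; ring)
    (by intro a b c; rw [smul_eq_mul, Finset.mul_sum]; refine Finset.sum_congr rfl fun i _ => ?_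
        simp; ring)
    (by intro a b c; rw [← Finset.sum_add_distrib]; refine Finset.sum_congr rfl fun i _ => ?_
        simp; ring)
    (by intro a b c; rw [smul_eq_mul, Finset.mul_sum]; refine Finset.sum_congr rfl fun i _ => ?_
        simp; ring)

lemma sympB_apply {n : ℕ} (u v : SympV n) :
    sympB n u v = ∑ i, (v.1 i * u.2 i - u.1 i * v.2 i) := rfl

lemma trSympForm_eq {n : ℕ} (u v : SympV n) : trSympForm 2 u v = sympB n u v := by
  unfold trSympForm
  rw [sympB_apply]
  have h : ∀ (A : Algebra (ZMod 2) (ZMod 2)) (x : ZMod 2),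
      @Algebra.trace (ZMod 2) (ZMod 2) _ _ A x = x := by
    intro A x
    obtain rfl : A = Algebra.id (ZMod 2) := Subsingleton.elim _ _
    exact Algebra.trace_self_apply x
  exact h _ _

lemma sympB_alt (n : ℕ) : (sympB n).IsAlt := by
  intro u
  rw [sympB_apply]
  exact Finset.sum_eq_zero fun i _ => by ring

lemma sympB_left {n : ℕ} (u : SympV n) (h : ∀ v, sympB n u v = 0) : u = 0 := by
  refine Prod.ext (funext fun i => ?_) (funext fun i => ?_)
  · have := h (0, Pi.single i 1)
    simpa [sympB_apply, Pi.single_apply] using this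
  · have := h (Pi.single i 1, 0)
    simpa [sympB_apply, Pi.single_apply] using this

lemma sympB_nondeg (n : ℕ) : (sympB n).Nondegenerate := by
  refine ⟨fun u h => sympB_left u h, fun u h => sympB_left u fun v => ?_⟩
  rw [← (sympB_alt n).neg_eq, h, neg_zero]

lemma finrank_sympV (n : ℕ) : finrank (ZMod 2) (SympV n) = 2 * n := by
  simp [two_mul]

lemma exists_hyperbolic {V : Type} [AddCommGroup V] [Module (ZMod 2) V]
    [FiniteDimensional (ZMod 2) V] (B : LinearMap.BilinForm (ZMod 2) V) (hB : B.IsAlt) (r : ℕ) :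
    ∀ W : Submodule (ZMod 2) V,
      2 * r + finrank (ZMod 2) (W ⊓ B.orthogonal W : Submodule (ZMod 2) V) ≤ finrank (ZMod 2) W →
      ∃ e g : Fin r → V, (∀ i, e i ∈ W) ∧ (∀ i, g i ∈ W) ∧ (∀ i j, B (e i) (e j) = 0) ∧
        (∀ i j, B (g i) (g j) = 0) ∧ (∀ i j, B (g i) (e j) = if i = j then 1 else 0) := by
  induction r with
  | zero =>
    intro W _
    exact ⟨fun _ => 0, fun _ => 0, by simp, by simp, by simp, by simp, fun i => i.elim0⟩
  | succ r ih =>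
    intro W hW
    have hex : ∃ e ∈ W, ∃ g ∈ W, B g e = 1 := by
      by_contra! hcon
      have h01 : ∀ x : ZMod 2, x ≠ 1 → x = 0 := by decide
      have : W ≤ B.orthogonal W := fun x hx y hy => h01 _ (hcon x hx y hy)
      rw [inf_eq_left.2 this] at hW
      omega
    obtain ⟨e, he, g, hg, hge⟩ := hex
    have heg : B e g = -1 := by rw [← hge, hB.neg_eq]
    have hr : B.IsRefl := hB.isRefl
    let W' : Submodule (ZMod 2) V := W ⊓ LinearMap.ker (B e) ⊓ LinearMap.ker (B g)
    have hW'm : ∀ x, x ∈ W' ↔ (x ∈ W ∧ B e x = 0) ∧ B g x = 0 := fun x => by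
      simp [W']
    have hdec : ∀ x ∈ W, x - (B g x) • e + (B e x) • g ∈ W' := by
      intro x hx
      rw [hW'm]
      refine ⟨⟨W.add_mem (W.sub_mem hx (W.smul_mem _ he)) (W.smul_mem _ hg), ?_⟩, ?_⟩
      · simp [hB.self_eq_zero, heg, CharTwo.add_self_eq_zero]
      · simp [hB.self_eq_zero, hge]
    have h1 : finrank (ZMod 2) W ≤ finrank (ZMod 2) W' + 2 := by
      have hle : W ≤ W' ⊔ (Submodule.span (ZMod 2) {e, g}) := by
        intro x hx
        have : x = (x - (B g x) • e + (B e x) • g) + ((B g x) • e - (B e x) • g) := by abel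
        rw [this]
        refine Submodule.add_mem_sup (hdec x hx) (Submodule.sub_mem _ ?_ ?_)
        · exact Submodule.smul_mem _ _ (Submodule.subset_span (by simp))
        · exact Submodule.smul_mem _ _ (Submodule.subset_span (by simp))
      have h2 := Submodule.finrank_mono hle
      have h3 := Submodule.finrank_add_le_finrank_add_finrank W' (Submodule.span (ZMod 2) {e, g})
      have h4 : finrank (ZMod 2) (Submodule.span (ZMod 2) {e, g}) ≤ 2 := by
        classical
        have := finrank_span_finset_le_card (R := ZMod 2) ({e, g} : Finset V)
        have h5 := Finset.card_le_two (a := e) (b := g)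
        rw [Set.finrank, Finset.coe_pair] at this
        omega
      omega
    have h2 : (W' ⊓ B.orthogonal W' : Submodule (ZMod 2) V) ≤ W ⊓ B.orthogonal W := by
      rintro w ⟨hw, hw'⟩
      have hw2 := (hW'm w).1 hw
      refine ⟨hw2.1.1, fun x hx => ?_⟩
      have h3 := hw' _ (hdec x hx)
      have h4 : B (x - (B g x) • e + (B e x) • g) w = 0 := h3
      simpa [hw2.1.2, hw2.2] using h4
    have h3 := Submodule.finrank_mono h2
    obtain ⟨e', g', he', hg', hee, hgg, hge'⟩ := ih W' (by omega)
    refine ⟨Fin.cons e e', Fin.cons g g', ?_, ?_, ?_, ?_, ?_⟩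
    · intro i; refine Fin.cases ?_ (fun i => ?_) i
      · simpa using he
      · simpa using ((hW'm _).1 (he' i)).1.1
    · intro i; refine Fin.cases ?_ (fun i => ?_) i
      · simpa using hg
      · simpa using ((hW'm _).1 (hg' i)).1.1
    · intro i j
      refine Fin.cases ?_ (fun i => ?_) i <;> refine Fin.cases ?_ (fun j => ?_) j
      · simp [hB.self_eq_zero]
      · simpa using ((hW'm _).1 (he' j)).1.2
      · simpa using hr _ _ ((hW'm _).1 (he' i)).1.2
      · simpa using hee i j
    · intro i j
      refine Fin.cases ?_ (fun i => ?_) i <;> refine Fin.cases ?_ (fun j => ?_) j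
      · simp [hB.self_eq_zero]
      · simpa using ((hW'm _).1 (hg' j)).2
      · simpa using hr _ _ ((hW'm _).1 (hg' i)).2
      · simpa using hgg i j
    · intro i j
      refine Fin.cases ?_ (fun i => ?_) i <;> refine Fin.cases ?_ (fun j => ?_) j
      · simp [hge]
      · simpa [(Fin.succ_ne_zero _).symm] using ((hW'm _).1 (he' j)).2
      · simpa [Fin.succ_ne_zero] using hr _ _ ((hW'm _).1 (hg' i)).1.2
      · simpa using hge' i j

lemma exists_embedding {n : ℕ} (r : ℕ) (W : Submodule (ZMod 2) (SympV n))
    (h : 2 * r + finrank (ZMod 2) (W ⊓ (sympB n).orthogonal W : Submodule (ZMod 2) (SympV n)) ≤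
      finrank (ZMod 2) W) :
    ∃ f : SympV r →ₗ[ZMod 2] SympV n, (∀ x, f x ∈ W) ∧
      ∀ x y, sympB n (f x) (f y) = sympB r x y := by
  obtain ⟨e, g, he, hg, hee, hgg, hge⟩ := exists_hyperbolic (sympB n) (sympB_alt n) r W h
  have heg : ∀ i j, sympB n (e i) (g j) = -(if i = j then 1 else 0) := fun i j => by
    rw [← (sympB_alt n).neg_eq, hge]; simp [eq_comm]
  refine ⟨(Fintype.linearCombination (ZMod 2) e).coprod (Fintype.linearCombination (ZMod 2) g),
    fun x => ?_, fun x y => ?_⟩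
  · simp only [LinearMap.coprod_apply, Fintype.linearCombination_apply]
    exact W.add_mem (W.sum_mem fun i _ => W.smul_mem _ (he i))
      (W.sum_mem fun i _ => W.smul_mem _ (hg i))
  · simp only [LinearMap.coprod_apply, Fintype.linearCombination_apply, map_add, map_sum,
      map_smul, LinearMap.add_apply, LinearMap.sum_apply, LinearMap.smul_apply, hee, hgg, hge, heg,
      sympB_apply x y, smul_eq_mul]
    simp [Finset.sum_add_distrib, mul_comm, CharTwo.sub_eq_add]

lemma swt_eq_sum {n : ℕ} (v : SympV n) :
    swt v = ∑ i, if (v.1 i = 0 ∧ v.2 i = 0) then 0 else 1 := by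
  classical
  unfold swt
  rw [Set.ncard_eq_toFinset_card', Set.toFinset_ofPred, Finset.card_filter]
  exact Finset.sum_congr rfl fun i _ => by split_ifs <;> simp_all

lemma swt_le {n : ℕ} (v : SympV n) : swt v ≤ n := by
  rw [swt_eq_sum]
  calc _ ≤ ∑ i : Fin n, 1 := Finset.sum_le_sum fun i _ => by split_ifs <;> simp
    _ = n := by simp

lemma swt_zero' {n : ℕ} : swt (0 : SympV n) = 0 := by
  rw [swt_eq_sum]; simp

/-- The first `a` coordinates. -/
def fstPart (a b : ℕ) : SympV (a + b) →ₗ[ZMod 2] SympV a where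
  toFun v := (fun i => v.1 (Fin.castAdd b i), fun i => v.2 (Fin.castAdd b i))
  map_add' _ _ := rfl
  map_smul' _ _ := rfl

/-- The last `b` coordinates. -/
def sndPart (a b : ℕ) : SympV (a + b) →ₗ[ZMod 2] SympV b where
  toFun v := (fun i => v.1 (Fin.natAdd a i), fun i => v.2 (Fin.natAdd a i))
  map_add' _ _ := rfl
  map_smul' _ _ := rfl

lemma swt_parts (a b : ℕ) (v : SympV (a + b)) :
    swt v = swt (fstPart a b v) + swt (sndPart a b v) := by
  simp only [swt_eq_sum, Fin.sum_univ_add]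
  rfl

lemma sympB_parts (a b : ℕ) (u v : SympV (a + b)) :
    sympB (a + b) u v = sympB a (fstPart a b u) (fstPart a b v) +
      sympB b (sndPart a b u) (sndPart a b v) := by
  simp only [sympB_apply, Fin.sum_univ_add]
  rfl

lemma parts_ext (a b : ℕ) (u v : SympV (a + b)) (h1 : fstPart a b u = fstPart a b v)
    (h2 : sndPart a b u = sndPart a b v) : u = v := by
  have h1a := congrArg Prod.fst h1
  have h1b := congrArg Prod.snd h1
  have h2a := congrArg Prod.fst h2
  have h2b := congrArg Prod.snd h2
  refine Prod.ext (funext fun i => ?_) (funext fun i => ?_)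
  · exact Fin.addCases (fun i => congrFun h1a i) (fun i => congrFun h2a i) i
  · exact Fin.addCases (fun i => congrFun h1b i) (fun i => congrFun h2b i) i

lemma exists_glue (a b : ℕ) : ∃ G : SympV a × SympV b →ₗ[ZMod 2] SympV (a + b),
    (∀ x, fstPart a b (G x) = x.1) ∧ (∀ x, sndPart a b (G x) = x.2) := by
  have hinj : Function.Injective ((fstPart a b).prod (sndPart a b)) := by
    intro u v h
    exact parts_ext a b u v (congrArg Prod.fst h) (congrArg Prod.snd h)
  have hfr : finrank (ZMod 2) (SympV (a + b)) = finrank (ZMod 2) (SympV a × SympV b) := by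
    rw [finrank_sympV, Module.finrank_prod, finrank_sympV, finrank_sympV]; ring
  let E := LinearEquiv.ofInjectiveOfFinrankEq _ hinj hfr
  refine ⟨E.symm.toLinearMap, fun x => ?_, fun x => ?_⟩
  · exact congrArg Prod.fst (E.apply_symm_apply x)
  · exact congrArg Prod.snd (E.apply_symm_apply x)

lemma finrank_orth {n : ℕ} (W : Submodule (ZMod 2) (SympV n)) :
    finrank (ZMod 2) W + finrank (ZMod 2) ((sympB n).orthogonal W) = 2 * n := by
  have h := LinearMap.BilinForm.finrank_orthogonal (sympB_nondeg n) W
  have h2 := Submodule.finrank_le W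
  rw [finrank_sympV] at h h2
  omega

lemma orth_orth {n : ℕ} (W : Submodule (ZMod 2) (SympV n)) :
    (sympB n).orthogonal ((sympB n).orthogonal W) = W :=
  LinearMap.BilinForm.orthogonal_orthogonal (sympB_nondeg n) (sympB_alt n).isRefl W

lemma sympDual_coe {n : ℕ} (W : Submodule (ZMod 2) (SympV n)) :
    sympDual 2 (W : Set (SympV n)) = ((sympB n).orthogonal W : Submodule (ZMod 2) (SympV n)) := by
  ext v
  simp only [sympDual, Set.mem_ofPred_eq, trSympForm_eq]
  exact ⟨fun h w hw => (sympB_alt n).isRefl _ _ (h w hw),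
    fun h w hw => (sympB_alt n).isRefl _ _ (h w hw)⟩

lemma natCard_sub {n : ℕ} (W : Submodule (ZMod 2) (SympV n)) :
    Nat.card W = 2 ^ finrank (ZMod 2) W := by
  rw [Module.natCard_eq_pow_finrank (K := ZMod 2)]; simp

/-- From a pure subsystem code to its isotropic radical. -/
lemma extract {n k r d : ℕ}
    (h : ∃ C : AddSubgroup (SympV n), IsSubsysCode 2 C (2 ^ k) (2 ^ r) d ∧ PureTo C d) :
    ∃ D : Submodule (ZMod 2) (SympV n), D ≤ (sympB n).orthogonal D ∧
      finrank (ZMod 2) D + (k + r) = n ∧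
      ∀ v ∈ (sympB n).orthogonal D, v ≠ 0 → d ≤ swt v := by
  obtain ⟨C, ⟨hc1, -, -, hd⟩, hp⟩ := h
  let C' : Submodule (ZMod 2) (SympV n) := AddSubgroup.toZModSubmodule 2 C
  have hC : (C : Set (SympV n)) = C' := rfl
  have hD : (C : Set (SympV n)) ∩ sympDual 2 (C : Set (SympV n)) =
      (C' ⊓ (sympB n).orthogonal C' : Submodule (ZMod 2) (SympV n)) := by
    rw [hC, sympDual_coe]; rfl
  rw [hD] at hc1 hd
  refine ⟨C' ⊓ (sympB n).orthogonal C', ?_, ?_, ?_⟩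
  · exact inf_le_right.trans (LinearMap.BilinForm.orthogonal_le inf_le_left)
  · have h2 := natCard_sub (C' ⊓ (sympB n).orthogonal C')
    have h3 : 2 ^ finrank (ZMod 2) (C' ⊓ (sympB n).orthogonal C' : Submodule (ZMod 2) (SympV n))
        * (2 ^ k * 2 ^ r) = Fintype.card (ZMod 2) ^ n := by
      rw [← h2]; exact hc1
    rw [ZMod.card, ← pow_add, ← pow_add] at h3
    exact Nat.pow_right_injective le_rfl h3
  · intro v hv hv0
    by_cases hvC : v ∈ C
    · exact hp v hvC hv0
    · rw [sympDual_coe] at hd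
      rw [hd (fun h => hvC (by
        have : v ∈ (C : Set (SympV n)) := h ▸ hv
        exact this))]
      exact Nat.sInf_le ⟨v, ⟨⟨hv, hvC⟩, hv0⟩, rfl⟩

/-- A subsystem code from a nested pair. -/
lemma build {n k r b : ℕ} (hk : 0 < k) (C D : Submodule (ZMod 2) (SympV n))
    (hD : C ⊓ (sympB n).orthogonal C = D) (h1 : finrank (ZMod 2) D + (k + r) = n)
    (h2 : finrank (ZMod 2) C = finrank (ZMod 2) D + 2 * r)
    (hw : ∀ v ∈ (sympB n).orthogonal D, v ∉ C → b ≤ swt v) :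
    ∃ d, b ≤ d ∧ ∃ C : AddSubgroup (SympV n), IsSubsysCode 2 C (2 ^ k) (2 ^ r) d := by
  have hDs : (C : Set (SympV n)) ∩ sympDual 2 (C : Set (SympV n)) = D := by
    rw [sympDual_coe, ← hD]; rfl
  have h3 := finrank_orth D
  have hne : (sympB n).orthogonal D ≠ C := fun h => by rw [h] at h3; omega
  have hle : C ≤ (sympB n).orthogonal D := by
    conv_lhs => rw [← orth_orth C]
    exact LinearMap.BilinForm.orthogonal_le (hD ▸ inf_le_right)
  refine ⟨minSwt (((sympB n).orthogonal D : Set (SympV n)) \ (C : Set (SympV n))), ?_,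
    C.toAddSubgroup, ?_⟩
  · obtain ⟨v, hv, hvC⟩ := SetLike.exists_of_lt (lt_of_le_of_ne hle hne.symm)
    have hmem := Nat.sInf_mem (s := swt '' ((((sympB n).orthogonal D : Set (SympV n)) \
      (C : Set (SympV n))) \ {0})) ⟨_, v, ⟨⟨hv, hvC⟩, fun h => hvC (h ▸ C.zero_mem)⟩, rfl⟩
    obtain ⟨w, ⟨⟨hw1, hw2⟩, -⟩, hw3⟩ := hmem
    rw [minSwt, ← hw3]
    exact hw w hw1 hw2
  · unfold IsSubsysCode
    rw [Submodule.coe_toAddSubgroup, hDs]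
    intro Ds
    have hDs2 : sympDual 2 Ds = _ := sympDual_coe D
    rw [hDs2]
    refine ⟨?_, ?_, fun h => absurd (SetLike.coe_injective h) hne, fun _ => rfl⟩
    · have := natCard_sub D
      rw [ZMod.card, ← pow_add]
      change Nat.card D * _ = _
      rw [this, ← pow_add, h1]
    · have := natCard_sub C
      rw [ZMod.card]
      change Nat.card C * _ = _
      rw [this, ← pow_add, ← pow_add]
      congr 1; omega

/-- Choosing a gauge group inside `D^⊥`. -/
lemma exists_gauge {n k r : ℕ} (D : Submodule (ZMod 2) (SympV n))
    (hD : D ≤ (sympB n).orthogonal D) (h1 : finrank (ZMod 2) D + k = n) (hr : r ≤ k) :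
    ∃ C : Submodule (ZMod 2) (SympV n), C ⊓ (sympB n).orthogonal C = D ∧
      finrank (ZMod 2) C = finrank (ZMod 2) D + 2 * r := by
  have h3 := finrank_orth D
  obtain ⟨f, hf, hff⟩ := exists_embedding r ((sympB n).orthogonal D) (by
    rw [orth_orth, inf_eq_right.2 hD]; omega)
  have hz : ∀ x y, f x ∈ D → sympB r x y = 0 := fun x y hx => by
    rw [← hff]; exact hf y _ hx
  have hz0 : ∀ x, f x ∈ D → x = 0 := fun x hx => sympB_left x fun y => hz x y hx
  refine ⟨D ⊔ LinearMap.range f, le_antisymm ?_ ?_, ?_⟩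
  · rintro v ⟨hv, hv'⟩
    obtain ⟨s, hs, t, ⟨x, rfl⟩, rfl⟩ := Submodule.mem_sup.1 hv
    have : x = 0 := sympB_left x fun y => by
      have h4 : sympB n (f y) (s + f x) = 0 :=
        hv' _ (Submodule.mem_sup_right (LinearMap.mem_range_self f y))
      have h5 : sympB n (f y) s = 0 := (sympB_alt n).isRefl _ _ (hf y s hs)
      rw [map_add, h5, zero_add, hff] at h4
      exact (sympB_alt r).isRefl _ _ h4
    simpa [this] using hs
  · refine le_inf le_sup_left fun s hs v hv => ?_
    obtain ⟨t, ht, u, ⟨x, rfl⟩, rfl⟩ := Submodule.mem_sup.1 hv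
    have h4 : sympB n t s = 0 := hD hs t ht
    have h5 : sympB n (f x) s = 0 := (sympB_alt n).isRefl _ _ (hf x s hs)
    change sympB n (t + f x) s = 0
    rw [map_add, LinearMap.add_apply, h4, h5, add_zero]
  · have hinj : Function.Injective f := by
      rw [injective_iff_map_eq_zero]
      intro x hx
      exact hz0 x (hx ▸ D.zero_mem)
    have h4 := Submodule.finrank_sup_add_finrank_inf_eq D (LinearMap.range f)
    have h5 : D ⊓ LinearMap.range f = ⊥ := by
      rw [eq_bot_iff]
      rintro v ⟨hv, x, rfl⟩
      simp [hz0 x hv]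
    rw [h5, finrank_bot, LinearMap.finrank_range_of_inj hinj, finrank_sympV] at h4
    omega

lemma combine_aux {a m n₂ k₁ d₁ d₂ r : ℕ}
    (D₁ : Submodule (ZMod 2) (SympV (a + m))) (D₂ : Submodule (ZMod 2) (SympV n₂))
    (h1 : D₁ ≤ (sympB _).orthogonal D₁) (h2 : D₂ ≤ (sympB _).orthogonal D₂)
    (hf1 : finrank (ZMod 2) D₁ + k₁ = a + m) (hf2 : finrank (ZMod 2) D₂ + a = n₂)
    (hw1 : ∀ v ∈ (sympB _).orthogonal D₁, v ≠ 0 → d₁ ≤ swt v)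
    (hw2 : ∀ v ∈ (sympB _).orthogonal D₂, v ≠ 0 → d₂ ≤ swt v) (hr : r < k₁) :
    ∃ d, min d₁ (d₁ + d₂ - a) ≤ d ∧ ∃ C : AddSubgroup (SympV (m + n₂)),
      IsSubsysCode 2 C (2 ^ (k₁ - r)) (2 ^ r) d := by
  obtain ⟨C₁, hC₁, hC₁f⟩ := exists_gauge D₁ h1 hf1 hr.le
  have hfo := finrank_orth D₂
  obtain ⟨f, hf, hff⟩ := exists_embedding a ((sympB n₂).orthogonal D₂) (by
    rw [orth_orth, inf_eq_right.2 h2]; omega)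
  have hz0 : ∀ x, f x ∈ D₂ → x = 0 := fun x hx => sympB_left x fun y => by
    rw [← hff]; exact hf y _ hx
  obtain ⟨G, hG1, hG2⟩ := exists_glue m n₂
  -- the gluing map
  let P : SympV (a + m) × D₂ →ₗ[ZMod 2] SympV (m + n₂) :=
    G ∘ₗ ((sndPart a m ∘ₗ LinearMap.fst _ _ _).prod
      (f ∘ₗ fstPart a m ∘ₗ LinearMap.fst _ _ _ + D₂.subtype ∘ₗ LinearMap.snd _ _ _))
  have hP1 : ∀ u s, fstPart m n₂ (P (u, s)) = sndPart a m u := fun u s => hG1 _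
  have hP2 : ∀ u s, sndPart m n₂ (P (u, s)) = f (fstPart a m u) + (s : SympV n₂) :=
    fun u s => hG2 _
  have hPB : ∀ u s v t, sympB _ (P (u, s)) (P (v, t)) = sympB _ u v := by
    intro u s v t
    rw [sympB_parts, sympB_parts, hP1, hP1, hP2, hP2, map_add, map_add, LinearMap.add_apply,
      LinearMap.add_apply, hff]
    have e1 : sympB n₂ (s : SympV n₂) (f (fstPart a m v)) = 0 := hf _ _ s.2
    have e2 : sympB n₂ (f (fstPart a m u)) (t : SympV n₂) = 0 :=
      (sympB_alt _).isRefl _ _ (hf _ _ t.2)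
    have e3 : sympB n₂ (s : SympV n₂) (t : SympV n₂) = 0 := h2 t.2 _ s.2
    rw [e1, e2, e3]; ring
  have hPinj : Function.Injective P := by
    rw [injective_iff_map_eq_zero]
    rintro ⟨u, s⟩ h
    have e1 := hP1 u s
    have e2 := hP2 u s
    rw [h, map_zero] at e1 e2
    have e3 : fstPart a m u = 0 := hz0 _ (by
      rw [eq_neg_of_add_eq_zero_left e2.symm]; exact D₂.neg_mem s.2)
    have hu : u = 0 := parts_ext a m u 0 (by rw [e3, map_zero]) (by rw [← e1, map_zero])
    have hs : s = 0 := by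
      rw [e3, map_zero, zero_add] at e2
      exact Subtype.ext e2.symm
    rw [hu, hs]; rfl
  let Q : Submodule (ZMod 2) (SympV (a + m)) → Submodule (ZMod 2) (SympV (m + n₂)) :=
    fun A => LinearMap.range (P ∘ₗ (A.subtype.prodMap LinearMap.id))
  have hQm : ∀ A u s, u ∈ A → P (u, s) ∈ Q A := fun A u s hu => ⟨(⟨u, hu⟩, s), rfl⟩
  have hQe : ∀ A, ∀ v ∈ Q A, ∃ u ∈ A, ∃ s, v = P (u, s) := by
    rintro A _ ⟨⟨⟨u, hu⟩, s⟩, rfl⟩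
    exact ⟨u, hu, s, rfl⟩
  have hQf : ∀ A, finrank (ZMod 2) (Q A) = finrank (ZMod 2) A + finrank (ZMod 2) D₂ := by
    intro A
    rw [LinearMap.finrank_range_of_inj, Module.finrank_prod]
    exact hPinj.comp (Function.Injective.prodMap A.injective_subtype Function.injective_id)
  have hfD1 := finrank_orth D₁
  -- the dual of the stabilizer
  have hdual : (sympB _).orthogonal (Q D₁) = Q ((sympB _).orthogonal D₁) := by
    symm
    apply Submodule.eq_of_le_of_finrank_eq
    · intro v hv w hw
      obtain ⟨u, hu, s, rfl⟩ := hQe _ v hv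
      obtain ⟨x, hx, t, rfl⟩ := hQe _ w hw
      change sympB _ (P (x, t)) (P (u, s)) = 0
      rw [hPB]; exact hu x hx
    · have := finrank_orth (Q D₁)
      rw [hQf] at this ⊢
      omega
  refine build (by omega) (Q C₁) (Q D₁) (le_antisymm ?_ ?_) ?_ ?_ ?_
  · rintro v ⟨hv, hv'⟩
    obtain ⟨u, hu, s, rfl⟩ := hQe _ v hv
    apply hQm
    rw [← hC₁]
    refine ⟨hu, fun x hx => ?_⟩
    have := hv' _ (hQm _ x 0 hx)
    change sympB _ (P (x, 0)) (P (u, s)) = 0 at this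
    rw [hPB] at this
    exact this
  · intro v hv
    obtain ⟨u, hu, s, rfl⟩ := hQe _ v hv
    rw [← hC₁] at hu
    refine ⟨hQm _ _ _ hu.1, fun w hw => ?_⟩
    obtain ⟨x, hx, t, rfl⟩ := hQe _ w hw
    change sympB _ (P (x, t)) (P (u, s)) = 0
    rw [hPB]; exact hu.2 x hx
  · rw [hQf]; omega
  · rw [hQf, hQf]; omega
  · intro v hv hvC
    rw [hdual] at hv
    obtain ⟨u, hu, s, rfl⟩ := hQe _ v hv
    have hu0 : u ≠ 0 := fun h => hvC (hQm _ _ _ (h ▸ C₁.zero_mem))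
    have hwu := hw1 u hu hu0
    rw [swt_parts] at hwu
    rw [swt_parts, hP1, hP2]
    by_cases h0 : fstPart a m u = 0
    · rw [h0, swt_zero'] at hwu
      omega
    · have hne : f (fstPart a m u) + (s : SympV n₂) ≠ 0 := fun h => h0 (hz0 _ (by
        rw [eq_neg_of_add_eq_zero_left h]; exact D₂.neg_mem s.2))
      have := hw2 _ (Submodule.add_mem _ (hf _) (h2 s.2)) hne
      have := swt_le (fstPart a m u)
      omega

end Helpers

/-- Combining binary subsystem codes.  Given pure
`[[n₁,k₁,r₁,d₁]]₂` and `[[n₂,k₂,r₂,d₂]]₂` Clifford subsystem codes with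
`k₂ + r₂ ≤ n₁`, for every `0 ≤ r < k₁ + r₁` there exists an
`[[n₁+n₂−k₂−r₂, k₁+r₁−r, r, d]]₂` Clifford subsystem code with
`d ≥ min{d₁, d₁+d₂−k₂−r₂}`. -/
theorem combining_binary_subsystem_codes
    (n₁ k₁ r₁ d₁ n₂ k₂ r₂ d₂ : ℕ) (hkr : k₂ + r₂ ≤ n₁)
    (h₁ : ∃ C : AddSubgroup ((Fin n₁ → ZMod 2) × (Fin n₁ → ZMod 2)),
      IsSubsysCode 2 C (2 ^ k₁) (2 ^ r₁) d₁ ∧ PureTo C d₁)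
    (h₂ : ∃ C : AddSubgroup ((Fin n₂ → ZMod 2) × (Fin n₂ → ZMod 2)),
      IsSubsysCode 2 C (2 ^ k₂) (2 ^ r₂) d₂ ∧ PureTo C d₂) :
    ∀ r : ℕ, r < k₁ + r₁ →
      ∃ d : ℕ, min d₁ (d₁ + d₂ - (k₂ + r₂)) ≤ d ∧
        ∃ C : AddSubgroup ((Fin (n₁ + n₂ - k₂ - r₂) → ZMod 2) ×
            (Fin (n₁ + n₂ - k₂ - r₂) → ZMod 2)),
          IsSubsysCode 2 C (2 ^ (k₁ + r₁ - r)) (2 ^ r) d := by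
  intro r hr
  obtain ⟨D₁, hD₁, hf₁, hw₁⟩ := extract h₁
  obtain ⟨D₂, hD₂, hf₂, hw₂⟩ := extract h₂
  clear h₁ h₂
  obtain ⟨m, rfl⟩ := Nat.exists_eq_add_of_le hkr
  have hN : k₂ + r₂ + m + n₂ - k₂ - r₂ = m + n₂ := by omega
  rw [hN]
  exact combine_aux D₁ D₂ hD₁ hD₂ hf₁ hf₂ hw₁ hw₂ hr
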